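/- arXiv:1608.00875 — 6 statements merged into one kernel-verified Lean document; each statement's English description precedes it below -/
import Mathlib

section
/- For every integer k ≥ 1, every 1 ≤ n ≤ N and every symmetric polynomial f in n variables with coefficients in k₀, the multiplication operator by the power sum p_k = Σ_{i=1}^N w_i^k satisfies [p_k, E_n[f]] = − E_n[g], where g is the symmetric polynomial in n variables given by g(v_1, …, v_n) = f(v_1, …, v_n) · Σ_{i=1}^n ((v_i + ħ)^k − v_i^k). -/
/-!
Setup: `k0 l` is the field k₀ = ℂ(ħ, t, z₁, …, z_l) and `KK l N` is the field
K = ℂ(ħ, t, z₁, …, z_l, w₁, …, w_N), realized as the rational function field in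
w₁, …, w_N over k₀.  Operators are k₀-linear endomorphisms of K, products of
operators denote composition, and `[A, B] = A * B - B * A`.
-/

open MvPolynomial Finset

set_option synthInstance.maxHeartbeats 1000000
set_option maxHeartbeats 2000000

noncomputable section

/-- The coefficient field k₀ = ℂ(ħ, t, z₁, …, z_l). -/
def k0 (l : ℕ) : Type := FractionRing (MvPolynomial (Fin 2 ⊕ Fin l) ℂ)

instance (l : ℕ) : Field (k0 l) := inferInstanceAs (Field (FractionRing _))
instance (l : ℕ) : Algebra (MvPolynomial (Fin 2 ⊕ Fin l) ℂ) (k0 l) :=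
  inferInstanceAs (Algebra _ (FractionRing _))
instance (l : ℕ) : IsFractionRing (MvPolynomial (Fin 2 ⊕ Fin l) ℂ) (k0 l) :=
  inferInstanceAs (IsFractionRing _ (FractionRing _))
instance (l : ℕ) : CharZero (k0 l) :=
  charZero_of_injective_algebraMap
    (IsFractionRing.injective (MvPolynomial (Fin 2 ⊕ Fin l) ℂ) (k0 l))

/-- The field K = ℂ(ħ, t, z₁, …, z_l, w₁, …, w_N), as k₀(w₁, …, w_N). -/
def KK (l N : ℕ) : Type := FractionRing (MvPolynomial (Fin N) (k0 l))

instance (l N : ℕ) : Field (KK l N) := inferInstanceAs (Field (FractionRing _))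
instance (l N : ℕ) : Algebra (MvPolynomial (Fin N) (k0 l)) (KK l N) :=
  inferInstanceAs (Algebra _ (FractionRing _))
instance (l N : ℕ) : IsFractionRing (MvPolynomial (Fin N) (k0 l)) (KK l N) :=
  inferInstanceAs (IsFractionRing _ (FractionRing _))
instance (l N : ℕ) : Algebra (k0 l) (KK l N) :=
  inferInstanceAs (Algebra _ (FractionRing (MvPolynomial (Fin N) (k0 l))))
instance (l N : ℕ) : IsScalarTower (k0 l) (MvPolynomial (Fin N) (k0 l)) (KK l N) :=
  inferInstanceAs (IsScalarTower _ _ (FractionRing _))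
instance (l N : ℕ) : CharZero (KK l N) :=
  charZero_of_injective_algebraMap
    (IsFractionRing.injective (MvPolynomial (Fin N) (k0 l)) (KK l N))

variable (l N : ℕ)

/-- ħ as an element of k₀. -/
def hb0 : k0 l := algebraMap (MvPolynomial (Fin 2 ⊕ Fin l) ℂ) (k0 l) (X (Sum.inl 0))
/-- t as an element of k₀. -/
def tt0 : k0 l := algebraMap (MvPolynomial (Fin 2 ⊕ Fin l) ℂ) (k0 l) (X (Sum.inl 1))
/-- z_k as an element of k₀. -/
def zz0 (k : Fin l) : k0 l := algebraMap (MvPolynomial (Fin 2 ⊕ Fin l) ℂ) (k0 l) (X (Sum.inr k))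

/-- ħ as an element of K. -/
def hbar : KK l N := algebraMap (k0 l) (KK l N) (hb0 l)
/-- t as an element of K. -/
def tt : KK l N := algebraMap (k0 l) (KK l N) (tt0 l)
/-- z_k as an element of K. -/
def zz (k : Fin l) : KK l N := algebraMap (k0 l) (KK l N) (zz0 l k)
/-- w_i as an element of K. -/
def ww (i : Fin N) : KK l N := algebraMap (MvPolynomial (Fin N) (k0 l)) (KK l N) (X i)

/-- The ring of k₀-linear endomorphisms of K; multiplication is composition. -/
abbrev Op (l N : ℕ) := Module.End (k0 l) (KK l N)

/-- The multiplication operator by an element of K. -/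
def mulOp (a : KK l N) : Op l N := LinearMap.mulLeft (k0 l) a

variable (u : Fin N → (KK l N ≃ₐ[k0 l] KK l N))

/-- The ordered product ∏_{i ∈ I} u_i (indices in increasing order; the u_i commute). -/
def prodU (I : Finset (Fin N)) : Op l N :=
  ((I.sort (· ≤ ·)).map (fun i => (u i).toLinearMap)).prod

/-- The operator E_n[f]. -/
def Eop (n : ℕ) (f : MvPolynomial (Fin n) (k0 l)) : Op l N :=
  ∑ I : Finset (Fin N),
    if h : I.card = n then
      mulOp l N
        ((aeval (fun m => ww l N (I.orderIsoOfFin h m).1) f) *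
          ∏ i ∈ I, ∏ j ∈ Iᶜ, (ww l N i - ww l N j - tt l N) / (ww l N i - ww l N j)) *
        prodU l N u I
    else 0

/-- A product of distinct shifts `u i` is an algebra automorphism shifting the listed variables. -/
theorem exists_algEquiv_list_prod
    (hu : ∀ i j, u i (ww l N j) = ww l N j + if j = i then hbar l N else 0)
    (L : List (Fin N)) (hL : L.Nodup) :
    ∃ σ : KK l N ≃ₐ[k0 l] KK l N,
      (∀ x, (L.map (fun i => (u i).toLinearMap)).prod x = σ x) ∧
      ∀ j, σ (ww l N j) = ww l N j + if j ∈ L then hbar l N else 0 := by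
  induction L with
  | nil => exact ⟨AlgEquiv.refl, fun x => by simp, fun j => by simp⟩
  | cons i L ih =>
    obtain ⟨hi, hL⟩ := List.nodup_cons.mp hL
    obtain ⟨σ, hσ, hw⟩ := ih hL
    refine ⟨σ.trans (u i), fun x => ?_, fun j => ?_⟩
    · rw [List.map_cons, List.prod_cons, Module.End.mul_apply, hσ]
      rfl
    · have hh : u i (hbar l N) = hbar l N := (u i).commutes _
      rw [AlgEquiv.trans_apply, hw, map_add, hu]
      by_cases hj : j = i
      · subst hj
        simp [hi]
      · by_cases hjL : j ∈ L <;> simp [hj, hjL, hh]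

theorem exists_algEquiv_prodU
    (hu : ∀ i j, u i (ww l N j) = ww l N j + if j = i then hbar l N else 0)
    (I : Finset (Fin N)) :
    ∃ σ : KK l N ≃ₐ[k0 l] KK l N, (∀ x, prodU l N u I x = σ x) ∧
      ∀ j, σ (ww l N j) = ww l N j + if j ∈ I then hbar l N else 0 := by
  simpa [prodU] using exists_algEquiv_list_prod l N u hu (I.sort (· ≤ ·)) (I.sort_nodup _)

/-- Evaluating the shift difference of the power sum at the variables indexed by `I`. -/
theorem aeval_sum_shift_pow_sub (k n : ℕ) (I : Finset (Fin N)) (h : I.card = n) :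
    aeval (fun m => ww l N (I.orderIsoOfFin h m).1)
        (∑ i : Fin n, ((X i + C (hb0 l)) ^ k - X i ^ k)) =
      ∑ i : Fin N, (ww l N i + if i ∈ I then hbar l N else 0) ^ k - ∑ i : Fin N, ww l N i ^ k := by
  have hC : ∀ g : Fin n → KK l N, aeval g (C (hb0 l)) = hbar l N := fun g => aeval_C g _
  simp only [map_sum, map_sub, map_pow, map_add, aeval_X, hC]
  rw [← Finset.sum_sub_distrib,
    ← Finset.sum_subset (Finset.subset_univ I) (fun i _ hi => by simp [hi]),
    ← Finset.sum_coe_sort I]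
  refine Fintype.sum_equiv (I.orderIsoOfFin h).toEquiv _ _ fun m => ?_
  simp

theorem statement0 (hN : 1 ≤ N)
    (hu : ∀ i j, u i (ww l N j) = ww l N j + if j = i then hbar l N else 0)
    (k : ℕ) (hk : 1 ≤ k) (n : ℕ) (hn1 : 1 ≤ n) (hnN : n ≤ N)
    (f : MvPolynomial (Fin n) (k0 l)) (hf : f.IsSymmetric) :
    mulOp l N (∑ i : Fin N, ww l N i ^ k) * Eop l N u n f
      - Eop l N u n f * mulOp l N (∑ i : Fin N, ww l N i ^ k)
      = - Eop l N u n (f * ∑ i : Fin n, ((X i + C (hb0 l)) ^ k - X i ^ k)) := by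
  simp only [Eop, Finset.mul_sum, Finset.sum_mul, ← Finset.sum_sub_distrib,
    ← Finset.sum_neg_distrib]
  refine Finset.sum_congr rfl fun I _ => ?_
  split_ifs with h
  · obtain ⟨σ, hσ, hw⟩ := exists_algEquiv_prodU l N u hu I
    rw [← Finset.mul_sum, map_mul, aeval_sum_shift_pow_sub]
    refine LinearMap.ext fun x => ?_
    simp only [LinearMap.sub_apply, LinearMap.neg_apply, Module.End.mul_apply, mulOp,
      LinearMap.mulLeft_apply, hσ, map_mul, map_sum, map_pow, hw]
    ring
  · simp
end
end

section
/- For every integer k ≥ 1, every 1 ≤ n ≤ N and every symmetric polynomial f in n variables with coefficients in k₀, the multiplication operator by the power sum p_k = Σ_{i=1}^N w_i^k satisfies [p_k, F_n[f]] = F_n[g], where g is the symmetric polynomial in n variables given by g(v_1, …, v_n) = f(v_1, …, v_n) · Σ_{i=1}^n ((v_i + ħ)^k − v_i^k). -/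
/-!
Setup: `k0 l` is the field k₀ = ℂ(ħ, t, z₁, …, z_l) and `KK l N` is the field
K = ℂ(ħ, t, z₁, …, z_l, w₁, …, w_N), realized as the rational function field in
w₁, …, w_N over k₀.  Operators are k₀-linear endomorphisms of K, products of
operators denote composition, and `[A, B] = A * B - B * A`.
-/

open MvPolynomial Finset

set_option synthInstance.maxHeartbeats 1000000
set_option maxHeartbeats 2000000

noncomputable section

variable (l N : ℕ)

variable (u : Fin N → (KK l N ≃ₐ[k0 l] KK l N))

/-- The operator F_n[f]. -/
def Fop (n : ℕ) (f : MvPolynomial (Fin n) (k0 l)) : Op l N :=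
  ∑ I : Finset (Fin N),
    if h : I.card = n then
      mulOp l N
        ((aeval (fun m => ww l N (I.orderIsoOfFin h m).1 - hbar l N) f) *
          ∏ i ∈ I, ∏ j ∈ Iᶜ, (ww l N i - ww l N j + tt l N) / (ww l N i - ww l N j)) *
        ((I.sort (· ≤ ·)).map
          (fun i => mulOp l N (∏ k : Fin l, (ww l N i - hbar l N - zz l N k)) *
            (u i).symm.toLinearMap)).prod
    else 0

theorem mulOp_mul_mulOp (a b : KK l N) : mulOp l N a * mulOp l N b = mulOp l N (a * b) :=
  LinearMap.ext fun x => (mul_assoc a b x).symm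

theorem toLinearMap_mul_mulOp (e : KK l N ≃ₐ[k0 l] KK l N) (a : KK l N) :
    (e.toLinearMap : Op l N) * mulOp l N a = mulOp l N (e a) * e.toLinearMap :=
  LinearMap.ext fun x => map_mul e a x

theorem mulOp_sub_mul (a b : KK l N) (P : Op l N) :
    mulOp l N (a - b) * P = mulOp l N a * P - mulOp l N b * P :=
  LinearMap.ext fun x => sub_mul a b (P x)

variable {l N u}

theorem symm_ww (hu : ∀ i j, u i (ww l N j) = ww l N j + if j = i then hbar l N else 0)
    (i j : Fin N) :
    (u i).symm (ww l N j) = ww l N j - if j = i then hbar l N else 0 := by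
  rw [AlgEquiv.symm_apply_eq, map_sub, hu]
  split_ifs <;> simp [hbar]

/-- Moving a power sum across a product of weighted inverse shifts along distinct indices
shifts exactly the corresponding variables. -/
theorem list_prod_mul_mulOp_powerSum
    (hu : ∀ i j, u i (ww l N j) = ww l N j + if j = i then hbar l N else 0)
    (a : Fin N → KK l N) (k : ℕ) (L : List (Fin N)) (hL : L.Nodup) :
    (L.map fun i => mulOp l N (a i) * ((u i).symm.toLinearMap : Op l N)).prod *
        mulOp l N (∑ j : Fin N, ww l N j ^ k) =
      mulOp l N (∑ j : Fin N, (ww l N j - if j ∈ L then hbar l N else 0) ^ k) *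
        (L.map fun i => mulOp l N (a i) * ((u i).symm.toLinearMap : Op l N)).prod := by
  induction L with
  | nil => simp
  | cons i L ih =>
    rw [List.nodup_cons] at hL
    have hshift : (u i).symm (∑ j : Fin N, (ww l N j - if j ∈ L then hbar l N else 0) ^ k) =
        ∑ j : Fin N, (ww l N j - if j ∈ i :: L then hbar l N else 0) ^ k := by
      rw [map_sum]
      refine Finset.sum_congr rfl fun j _ => ?_
      rw [map_pow, map_sub, symm_ww hu]
      have hbar_fixed : (u i).symm (hbar l N) = hbar l N := (u i).symm.commutes _
      by_cases hji : j = i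
      · subst hji
        simp [hL.1]
      · by_cases hjL : j ∈ L <;> simp [hji, hjL, hbar_fixed]
    rw [List.map_cons, List.prod_cons, mul_assoc, ih hL.2, ← mul_assoc, mul_assoc (mulOp l N (a i)),
      toLinearMap_mul_mulOp, hshift, ← mul_assoc, mulOp_mul_mulOp, mul_comm (a i),
      ← mulOp_mul_mulOp]
    simp only [mul_assoc]

theorem powerSum_sub_shifted_powerSum (k n : ℕ) (I : Finset (Fin N)) (h : I.card = n) :
    (∑ j : Fin N, ww l N j ^ k) -
        ∑ j : Fin N, (ww l N j - if j ∈ I.sort (· ≤ ·) then hbar l N else 0) ^ k =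
      aeval (fun m => ww l N (I.orderIsoOfFin h m).1 - hbar l N)
        (∑ i : Fin n, ((X i + C (hb0 l)) ^ k - X i ^ k)) := by
  have hC : algebraMap (k0 l) (KK l N) (hb0 l) = hbar l N := rfl
  simp only [map_sum, map_sub, map_pow, map_add, aeval_X, aeval_C, hC, sub_add_cancel,
    Finset.mem_sort]
  refine Eq.trans ?_ ((I.orderIsoOfFin h).toEquiv.sum_comp
    (fun j : I => ww l N j.1 ^ k - (ww l N j.1 - hbar l N) ^ k)).symm
  rw [Finset.sum_coe_sort I (fun j => ww l N j ^ k - (ww l N j - hbar l N) ^ k),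
    ← Finset.sum_sub_distrib, ← Finset.sum_subset (Finset.subset_univ I)]
  · exact Finset.sum_congr rfl fun j hj => by rw [if_pos hj]
  · intro j _ hj
    rw [if_neg hj, sub_zero, sub_self]

variable (l N u)

theorem statement1 (hN : 1 ≤ N)
    (hu : ∀ i j, u i (ww l N j) = ww l N j + if j = i then hbar l N else 0)
    (k : ℕ) (hk : 1 ≤ k) (n : ℕ) (hn1 : 1 ≤ n) (hnN : n ≤ N)
    (f : MvPolynomial (Fin n) (k0 l)) (hf : f.IsSymmetric) :
    mulOp l N (∑ i : Fin N, ww l N i ^ k) * Fop l N u n f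
      - Fop l N u n f * mulOp l N (∑ i : Fin N, ww l N i ^ k)
      = Fop l N u n (f * ∑ i : Fin n, ((X i + C (hb0 l)) ^ k - X i ^ k)) := by
  simp only [Fop]
  rw [Finset.mul_sum, Finset.sum_mul, ← Finset.sum_sub_distrib]
  refine Finset.sum_congr rfl fun I _ => ?_
  by_cases h : I.card = n
  · rw [dif_pos h, dif_pos h, map_mul, ← powerSum_sub_shifted_powerSum k n I h, mul_assoc,
      list_prod_mul_mulOp_powerSum hu _ k _ (Finset.sort_nodup I (· ≤ ·)), ← mul_assoc,
      ← mul_assoc, mulOp_mul_mulOp, mulOp_mul_mulOp, ← mulOp_sub_mul]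
    congr 2
    ring
  · rw [dif_neg h, dif_neg h, mul_zero, zero_mul, sub_zero]
end
end

section
/- Set w̄_i = w_i − (N−1)t. For every integer n ≥ 1 and every polynomial f in one variable with coefficients in k₀, the commutator of the multiplication operator by Σ_{i=1}^N B̄_n(w̄_i) with E_1[f] satisfies [Σ_{i=1}^N B̄_n(w̄_i), E_1[f]] = − ħ · E_1[g], where g is the one-variable polynomial g(v) = f(v) · (v − (N−1)t + ħ)^{n−1}. -/
/-!
Setup: `k0 l` is the field k₀ = ℂ(ħ, t, z₁, …, z_l) and `KK l N` is the field
K = ℂ(ħ, t, z₁, …, z_l, w₁, …, w_N), realized as the rational function field in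
w₁, …, w_N over k₀.  Operators are k₀-linear endomorphisms of K, products of
operators denote composition, and `[A, B] = A * B - B * A`.
-/

open MvPolynomial Finset

set_option synthInstance.maxHeartbeats 1000000
set_option maxHeartbeats 2000000

noncomputable section

variable (l N : ℕ)

/-- The normalized Bernoulli polynomial B̄_n(w) = (−ħ)^n B_n(−w/ħ)/n evaluated at v ∈ K. -/
def Bbar (n : ℕ) (v : KK l N) : KK l N :=
  ((-(hbar l N)) ^ n *
    Polynomial.aeval (-v / hbar l N) ((Polynomial.bernoulli n).map (algebraMap ℚ (KK l N)))) /
    (n : KK l N)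

/-- w̄_i = w_i − (N−1)t. -/
def wbar (i : Fin N) : KK l N := ww l N i - ((N - 1 : ℕ) : KK l N) * tt l N

variable (u : Fin N → (KK l N ≃ₐ[k0 l] KK l N))

/-- The operator E₁[f] for a one-variable polynomial f with coefficients in k₀. -/
def E1op (f : Polynomial (k0 l)) : Op l N :=
  ∑ i : Fin N,
    mulOp l N
      (Polynomial.aeval (ww l N i) f *
        ∏ j ∈ ({i}ᶜ : Finset (Fin N)), (ww l N i - ww l N j - tt l N) / (ww l N i - ww l N j)) *
      (u i).toLinearMap

theorem hbar_ne_zero : hbar l N ≠ 0 := by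
  rw [hbar, hb0, Ne, FaithfulSMul.algebraMap_eq_zero_iff,
    IsFractionRing.to_map_eq_zero_iff]
  exact X_ne_zero _

/-- The difference equation `B_n(1 + x) = B_n(x) + n x^(n-1)` over any `ℚ`-algebra. -/
theorem aeval_bernoulli_one_add {A : Type*} [CommRing A] [Algebra ℚ A] (n : ℕ) (x : A) :
    Polynomial.aeval (1 + x) (Polynomial.bernoulli n) =
      Polynomial.aeval x (Polynomial.bernoulli n) + (n : A) * x ^ (n - 1) := by
  have h := congrArg (Polynomial.aeval x) (Polynomial.bernoulli_comp_one_add_X n)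
  simpa [Polynomial.aeval_comp] using h

theorem Bbar_add_hbar (n : ℕ) (hn : 1 ≤ n) (v : KK l N) :
    Bbar l N n (v + hbar l N) = Bbar l N n v + hbar l N * (v + hbar l N) ^ (n - 1) := by
  have hh := hbar_ne_zero l N
  obtain ⟨m, rfl⟩ := Nat.exists_eq_add_of_le' hn
  have hm : ((m + 1 : ℕ) : KK l N) ≠ 0 := Nat.cast_ne_zero.mpr m.succ_ne_zero
  have hv : -v / hbar l N = 1 + -(v + hbar l N) / hbar l N := by
    field_simp
    ring
  have hpow : (-hbar l N) ^ (m + 1) * (-(v + hbar l N) / hbar l N) ^ m =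
      -(hbar l N * (v + hbar l N) ^ m) := by
    rw [pow_succ', mul_assoc, ← mul_pow, neg_mul_comm, neg_mul_comm]
    field_simp
  unfold Bbar
  rw [Polynomial.aeval_map_algebraMap, Polynomial.aeval_map_algebraMap, hv,
    aeval_bernoulli_one_add, Nat.add_sub_cancel, mul_add, mul_left_comm, hpow, add_div,
    mul_div_cancel_left₀ _ hm]
  ring

theorem map_Bbar (σ : KK l N ≃ₐ[k0 l] KK l N) (n : ℕ) (v : KK l N) :
    σ (Bbar l N n v) = Bbar l N n (σ v) := by
  have hσ : σ (hbar l N) = hbar l N := σ.commutes _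
  have haeval (x : KK l N) (p : Polynomial ℚ) :
      σ (Polynomial.aeval x p) = Polynomial.aeval (σ x) p :=
    (Polynomial.aeval_algHom_apply (σ : KK l N →+* KK l N).toRatAlgHom x p).symm
  simp only [Bbar, Polynomial.aeval_map_algebraMap, map_div₀, map_mul, map_pow, map_neg,
    map_natCast, haeval, hσ]

theorem map_sum_Bbar_wbar (σ : KK l N ≃ₐ[k0 l] KK l N) (i : Fin N)
    (hσ : ∀ j, σ (ww l N j) = ww l N j + if j = i then hbar l N else 0)
    (n : ℕ) (hn : 1 ≤ n) :
    σ (∑ j, Bbar l N n (wbar l N j)) =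
      (∑ j, Bbar l N n (wbar l N j)) + hbar l N * (wbar l N i + hbar l N) ^ (n - 1) := by
  have ht : σ (tt l N) = tt l N := σ.commutes _
  have hw (j : Fin N) : σ (wbar l N j) = wbar l N j + if j = i then hbar l N else 0 := by
    simp only [wbar, map_sub, map_mul, map_natCast, ht, hσ]
    ring
  have hB (j : Fin N) : Bbar l N n (σ (wbar l N j)) = Bbar l N n (wbar l N j) +
      if j = i then hbar l N * (wbar l N i + hbar l N) ^ (n - 1) else 0 := by
    rw [hw]
    split_ifs with h
    · rw [Bbar_add_hbar l N n hn, h]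
    · simp
  simp [map_sum, map_Bbar, hB, Finset.sum_add_distrib]

theorem statement2 (hN : 1 ≤ N)
    (hu : ∀ i j, u i (ww l N j) = ww l N j + if j = i then hbar l N else 0)
    (n : ℕ) (hn : 1 ≤ n) (f : Polynomial (k0 l)) :
    mulOp l N (∑ i : Fin N, Bbar l N n (wbar l N i)) * E1op l N u f
      - E1op l N u f * mulOp l N (∑ i : Fin N, Bbar l N n (wbar l N i))
      = -(mulOp l N (hbar l N) *
          E1op l N u (f * (Polynomial.X +
            Polynomial.C (hb0 l - ((N - 1 : ℕ) : k0 l) * tt0 l)) ^ (n - 1))) := by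
  ext x
  have hc (i : Fin N) : Polynomial.aeval (ww l N i) (Polynomial.X +
      Polynomial.C (hb0 l - ((N - 1 : ℕ) : k0 l) * tt0 l)) = wbar l N i + hbar l N := by
    simp only [wbar, hbar, tt, map_add, Polynomial.aeval_X, Polynomial.aeval_C, map_sub,
      map_mul, map_natCast]
    ring
  simp only [E1op, mulOp, LinearMap.sub_apply, LinearMap.neg_apply, Module.End.mul_apply,
    LinearMap.sum_apply, LinearMap.mulLeft_apply, AlgEquiv.toLinearMap_apply, map_mul, map_pow,
    map_sum_Bbar_wbar l N _ _ (hu _) n hn, hc]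
  rw [Finset.mul_sum, Finset.mul_sum, ← Finset.sum_sub_distrib, ← Finset.sum_neg_distrib]
  exact Finset.sum_congr rfl fun i _ => by ring
end
end

section
/- In the field of rational functions ℂ(ħ, t, x, w_1, …, w_N) the following identity holds: Σ_{i=1}^N [ (xt/(1 − (w_i + ħ)x)) ∏_{s≠i} ((w_i − w_s − t)(w_i + ħ − w_s + t))/((w_i − w_s)(w_i + ħ − w_s)) − (xt/(1 − w_i x)) ∏_{s≠i} ((w_i − w_s + t)(w_i − ħ − w_s − t))/((w_i − w_s)(w_i − ħ − w_s)) ] = − (ħ/(ħ + t)) · ( ∏_{i=1}^N ((1 − (w_i − t)x)(1 − (w_i + ħ + t)x))/((1 − w_i x)(1 − (w_i + ħ)x)) − 1 ). -/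
/-!
The field ℂ(ħ, t, x, w₁, …, w_N) of rational functions over ℂ, realized as the
fraction field of the polynomial ring in the indeterminates ħ, t, x, w₁, …, w_N.
-/

open MvPolynomial Finset

set_option synthInstance.maxHeartbeats 1000000
set_option maxHeartbeats 2000000

noncomputable section

/-- The field ℂ(ħ, t, x, w₁, …, w_N). -/
def K5 (N : ℕ) : Type := FractionRing (MvPolynomial (Fin 3 ⊕ Fin N) ℂ)

instance (N : ℕ) : Field (K5 N) := inferInstanceAs (Field (FractionRing _))
instance (N : ℕ) : Algebra (MvPolynomial (Fin 3 ⊕ Fin N) ℂ) (K5 N) :=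
  inferInstanceAs (Algebra _ (FractionRing _))

variable (N : ℕ)

/-- ħ. -/
def hh : K5 N := algebraMap (MvPolynomial (Fin 3 ⊕ Fin N) ℂ) (K5 N) (X (Sum.inl 0))
/-- t. -/
def tv : K5 N := algebraMap (MvPolynomial (Fin 3 ⊕ Fin N) ℂ) (K5 N) (X (Sum.inl 1))
/-- x. -/
def xv : K5 N := algebraMap (MvPolynomial (Fin 3 ⊕ Fin N) ℂ) (K5 N) (X (Sum.inl 2))
/-- w_i. -/
def wv (i : Fin N) : K5 N := algebraMap (MvPolynomial (Fin 3 ⊕ Fin N) ℂ) (K5 N) (X (Sum.inr i))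

/-- Partial fractions for a ratio of two products of the same number of linear factors, written
in the inverse variable `x`. -/
theorem prod_one_sub_div_sub_one {F ι : Type*} [Field F] [DecidableEq ι] (s : Finset ι)
    (u v : ι → F) (hv : Set.InjOn v s) (x : F) (hx : ∀ i ∈ s, 1 - v i * x ≠ 0) :
    (∏ i ∈ s, (1 - u i * x) / (1 - v i * x)) - 1 =
      ∑ i ∈ s, (v i - u i) * x / (1 - v i * x) *
        ∏ k ∈ s.erase i, (v i - u k) / (v i - v k) := by
  rcases eq_or_ne x 0 with rfl | hx0
  · simp
  have scale (a : F) : 1 - a * x = x * (x⁻¹ - a) := by field_simp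
  have hy : ∀ i ∈ s, x⁻¹ ≠ v i := fun i hi h ↦ hx i hi (by rw [scale, h, sub_self, mul_zero])
  have hprod : (∏ i ∈ s, (1 - u i * x) / (1 - v i * x)) =
      (Lagrange.nodal s u).eval x⁻¹ / (Lagrange.nodal s v).eval x⁻¹ := by
    rw [Lagrange.eval_nodal, Lagrange.eval_nodal, ← Finset.prod_div_distrib]
    exact Finset.prod_congr rfl fun i _ ↦ by rw [scale, scale, mul_div_mul_left _ _ hx0]
  have hnod : (Lagrange.nodal s v).eval x⁻¹ ≠ 0 := Lagrange.eval_nodal_not_at_node hy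
  have hdeg : (Lagrange.nodal s u - Lagrange.nodal s v).degree < s.card := by
    have h := Polynomial.degree_sub_lt_left (p := Lagrange.nodal s u) (q := Lagrange.nodal s v)
      (by rw [Lagrange.degree_nodal, Lagrange.degree_nodal]) (Lagrange.nodal_ne_zero)
      (by rw [Lagrange.nodal_monic.leadingCoeff, Lagrange.nodal_monic.leadingCoeff])
    rwa [Lagrange.degree_nodal] at h
  have key := congrArg (Polynomial.eval x⁻¹) (Lagrange.eq_interpolate hv hdeg)
  rw [Lagrange.eval_interpolate_not_at_node _ hy, Polynomial.eval_sub] at key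
  rw [hprod, div_sub_one hnod, key, mul_div_cancel_left₀ _ hnod]
  refine Finset.sum_congr rfl fun i hi ↦ ?_
  rw [Polynomial.eval_sub, Lagrange.eval_nodal_at_node hi, sub_zero, Lagrange.eval_nodal,
    ← Finset.mul_prod_erase s _ hi, Lagrange.nodalWeight, scale, Finset.prod_div_distrib,
    Finset.prod_inv_distrib]
  have h1 : x⁻¹ - v i ≠ 0 := sub_ne_zero.2 (hy i hi)
  have h2 : ∏ k ∈ s.erase i, (v i - v k) ≠ 0 := Finset.prod_ne_zero_iff.2 fun k hk ↦
    sub_ne_zero.2 fun h ↦ (Finset.mem_erase.1 hk).1 (hv (Finset.mem_erase.1 hk).2 hi h.symm)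
  rw [mul_comm (v i - u i) x, mul_div_mul_left _ _ hx0]
  field_simp

theorem prod_erase_inl {M α β : Type*} [CommMonoid M] [Fintype α] [Fintype β] [DecidableEq α]
    [DecidableEq β] (f : α ⊕ β → M) (a : α) :
    ∏ k ∈ univ.erase (Sum.inl a), f k = (∏ s ∈ {a}ᶜ, f (Sum.inl s)) * ∏ s, f (Sum.inr s) := by
  have h : (univ : Finset (α ⊕ β)).erase (Sum.inl a) = ({a}ᶜ : Finset α).disjSum univ := by
    ext (k | k) <;> simp
  rw [h, prod_disjSum]

theorem prod_erase_inr {M α β : Type*} [CommMonoid M] [Fintype α] [Fintype β] [DecidableEq α]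
    [DecidableEq β] (f : α ⊕ β → M) (b : β) :
    ∏ k ∈ univ.erase (Sum.inr b), f k = (∏ s, f (Sum.inl s)) * ∏ s ∈ {b}ᶜ, f (Sum.inr s) := by
  have h : (univ : Finset (α ⊕ β)).erase (Sum.inr b) = univ.disjSum ({b}ᶜ : Finset β) := by
    ext (k | k) <;> simp
  rw [h, prod_disjSum]

/-- The identity for elements of an arbitrary field at which no denominator vanishes. -/
theorem sum_residues_eq {F ι : Type*} [Field F] [Fintype ι] [DecidableEq ι] (h t x : F)
    (w : ι → F) (h0 : h ≠ 0) (ht : h + t ≠ 0) (hw : Function.Injective w)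
    (hwh : ∀ i j, w i ≠ w j + h) (hx : ∀ i, 1 - w i * x ≠ 0)
    (hxh : ∀ i, 1 - (w i + h) * x ≠ 0) :
    (∑ i, ((x * t / (1 - (w i + h) * x)) *
          ∏ s ∈ ({i}ᶜ : Finset ι), ((w i - w s - t) * (w i + h - w s + t)) /
              ((w i - w s) * (w i + h - w s))
        - (x * t / (1 - w i * x)) *
          ∏ s ∈ ({i}ᶜ : Finset ι), ((w i - w s + t) * (w i - h - w s - t)) /
              ((w i - w s) * (w i - h - w s))))
    = -(h / (h + t)) * ((∏ i, ((1 - (w i - t) * x) * (1 - (w i + h + t) * x)) /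
            ((1 - w i * x) * (1 - (w i + h) * x))) - 1) := by
  have hv : Function.Injective (Sum.elim w fun i ↦ w i + h) :=
    hw.sumElim (fun i j e ↦ hw (add_right_cancel e)) hwh
  have key := prod_one_sub_div_sub_one univ
    (Sum.elim (fun i ↦ w i - t) fun i ↦ w i + h + t) (Sum.elim w fun i ↦ w i + h) hv.injOn x
    (by rintro (i | i) -
        · exact hx i
        · exact hxh i)
  simp only [Fintype.prod_sum_type, Fintype.sum_sum_type, Sum.elim_inl, Sum.elim_inr,
    prod_erase_inl, prod_erase_inr] at key
  rw [← prod_mul_distrib] at key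
  simp only [div_mul_div_comm] at key
  rw [key, ← sum_add_distrib, mul_sum]
  refine sum_congr rfl fun i _ ↦ ?_
  rw [Fintype.prod_eq_mul_prod_compl i fun s ↦ (w i - (w s + h + t)) / (w i - (w s + h)),
    Fintype.prod_eq_mul_prod_compl i fun s ↦ (w i + h - (w s - t)) / (w i + h - w s)]
  have e1 : ∏ s ∈ ({i}ᶜ : Finset ι), ((w i - w s - t) * (w i + h - w s + t)) /
      ((w i - w s) * (w i + h - w s)) = ∏ s ∈ ({i}ᶜ : Finset ι),
        (w i + h - (w s - t)) / (w i + h - w s) *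
          ((w i + h - (w s + h + t)) / (w i + h - (w s + h))) :=
    prod_congr rfl fun s _ ↦ by rw [div_mul_div_comm]; congr 1 <;> ring
  have e2 : ∏ s ∈ ({i}ᶜ : Finset ι), ((w i - w s + t) * (w i - h - w s - t)) /
      ((w i - w s) * (w i - h - w s)) = ∏ s ∈ ({i}ᶜ : Finset ι),
        (w i - (w s - t)) / (w i - w s) * ((w i - (w s + h + t)) / (w i - (w s + h))) :=
    prod_congr rfl fun s _ ↦ by rw [div_mul_div_comm]; congr 1 <;> ring
  have f1 : (w i - (w i + h + t)) / (w i - (w i + h)) = (h + t) / h := by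
    rw [← neg_div_neg_eq]; congr 1 <;> ring
  have f2 : (w i + h - (w i - t)) / (w i + h - w i) = (h + t) / h := by congr 1 <;> ring
  rw [e1, e2, prod_mul_distrib, prod_mul_distrib, f1, f2]
  have cancel : h / (h + t) * ((h + t) / h) = 1 := by field_simp
  linear_combination (x * t / (1 - w i * x) *
      ((∏ s ∈ ({i}ᶜ : Finset ι), (w i - (w s - t)) / (w i - w s)) *
        ∏ s ∈ ({i}ᶜ : Finset ι), (w i - (w s + h + t)) / (w i - (w s + h))) -
    x * t / (1 - (w i + h) * x) *
      ((∏ s ∈ ({i}ᶜ : Finset ι), (w i + h - (w s - t)) / (w i + h - w s)) *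
        ∏ s ∈ ({i}ᶜ : Finset ι), (w i + h - (w s + h + t)) / (w i + h - (w s + h)))) * cancel

instance (N : ℕ) : IsFractionRing (MvPolynomial (Fin 3 ⊕ Fin N) ℂ) (K5 N) :=
  inferInstanceAs (IsFractionRing _ (FractionRing _))

theorem algebraMap_ne_zero_of_eval_ne_zero {N : ℕ} {p : MvPolynomial (Fin 3 ⊕ Fin N) ℂ}
    (a : Fin 3 ⊕ Fin N → ℂ) (hp : eval a p ≠ 0) : algebraMap _ (K5 N) p ≠ 0 := by
  intro h
  rw [IsFractionRing.to_map_eq_zero_iff] at h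
  exact hp (by rw [h, map_zero])

theorem statement5 (hN : 1 ≤ N) :
    (∑ i : Fin N,
      ((xv N * tv N / (1 - (wv N i + hh N) * xv N)) *
          ∏ s ∈ ({i}ᶜ : Finset (Fin N)),
            ((wv N i - wv N s - tv N) * (wv N i + hh N - wv N s + tv N)) /
              ((wv N i - wv N s) * (wv N i + hh N - wv N s))
        - (xv N * tv N / (1 - wv N i * xv N)) *
          ∏ s ∈ ({i}ᶜ : Finset (Fin N)),
            ((wv N i - wv N s + tv N) * (wv N i - hh N - wv N s - tv N)) /
              ((wv N i - wv N s) * (wv N i - hh N - wv N s))))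
    = -(hh N / (hh N + tv N)) *
        ((∏ i : Fin N,
          ((1 - (wv N i - tv N) * xv N) * (1 - (wv N i + hh N + tv N) * xv N)) /
            ((1 - wv N i * xv N) * (1 - (wv N i + hh N) * xv N))) - 1) := by
  refine sum_residues_eq _ _ _ _ ?_ ?_ ?_ ?_ ?_ ?_
  · exact algebraMap_ne_zero_of_eval_ne_zero (fun _ ↦ 1) (by simp)
  · rw [hh, tv, ← map_add]
    exact algebraMap_ne_zero_of_eval_ne_zero (fun _ ↦ 1) (by norm_num)
  · intro i j hij
    exact Sum.inr_injective (X_injective (IsFractionRing.injective _ (K5 N) hij))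
  · intro i j
    rw [← sub_ne_zero, wv, wv, hh, ← map_add, ← map_sub]
    exact algebraMap_ne_zero_of_eval_ne_zero (fun _ ↦ 1) (by simp)
  · intro i
    rw [wv, xv, ← map_mul, ← map_one (algebraMap (MvPolynomial (Fin 3 ⊕ Fin N) ℂ) (K5 N)),
      ← map_sub]
    exact algebraMap_ne_zero_of_eval_ne_zero (fun _ ↦ 0) (by simp)
  · intro i
    rw [wv, hh, xv, ← map_add, ← map_mul,
      ← map_one (algebraMap (MvPolynomial (Fin 3 ⊕ Fin N) ℂ) (K5 N)), ← map_sub]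
    exact algebraMap_ne_zero_of_eval_ne_zero (fun _ ↦ 0) (by simp)
end
end

section
/- For all 1 ≤ i < j ≤ N, the trigonometric Dunkl operators and the permutation operators satisfy σ_{ij} ∘ D_i = D_j ∘ σ_{ij} − t·(Id + Σ_{k=i+1}^{j−1} σ_{ik} ∘ σ_{kj}) as linear endomorphisms of F. -/
/-!
Setup: `k0 l` is the field k₀ = ℂ(ħ, t, z₁, …, z_l) and `KK l N` is the field
K = ℂ(ħ, t, z₁, …, z_l, w₁, …, w_N), realized as the rational function field in
w₁, …, w_N over k₀.  Operators are k₀-linear endomorphisms of K, products of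
operators denote composition, and `[A, B] = A * B - B * A`.
-/

open MvPolynomial Finset

set_option synthInstance.maxHeartbeats 1000000
set_option maxHeartbeats 2000000

noncomputable section

variable (l N : ℕ)

/- Here we write X_i for the generator `ww l N i` of F = ℂ(ħ, t, z₁, …, z_l)(X₁, …, X_N),
`σ i k` (for i ≠ k) is the field automorphism exchanging X_i and X_k and fixing the other
generators, and `pd i` is the partial derivative ∂_i (a k₀-linear derivation with
∂_i X_j = δ_{ij}), both taken as parameters characterized by hypotheses in the theorem. -/

variable (σ : Fin N → Fin N → (KK l N ≃ₐ[k0 l] KK l N))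
variable (pd : Fin N → Module.End (k0 l) (KK l N))

/-- σ_{ik} as a k₀-linear endomorphism. -/
def sL (i k : Fin N) : Op l N := (σ i k).toLinearMap

/-- The trigonometric Dunkl operator
D_i = −ħ X_i ∂_i + t Σ_{k≠i} (X_i/(X_i − X_k))(1 − σ_{ik}) + t Σ_{k<i} σ_{ik}. -/
def Dop (i : Fin N) : Op l N :=
  -(mulOp l N (hbar l N * ww l N i) * pd i)
  + ∑ k ∈ ({i}ᶜ : Finset (Fin N)),
      mulOp l N (tt l N * (ww l N i / (ww l N i - ww l N k))) * (1 - sL l N σ i k)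
  + ∑ k ∈ Finset.Iio i, mulOp l N (tt l N) * sL l N σ i k

/-- A `k0 l`-algebra endomorphism of `KK l N` is determined by its values on the generators. -/
theorem KK.algHom_ext {φ ψ : KK l N →ₐ[k0 l] KK l N} (h : ∀ m, φ (ww l N m) = ψ (ww l N m)) :
    φ = ψ := by
  have hpoly : φ.comp (IsScalarTower.toAlgHom (k0 l) (MvPolynomial (Fin N) (k0 l)) (KK l N))
      = ψ.comp (IsScalarTower.toAlgHom (k0 l) (MvPolynomial (Fin N) (k0 l)) (KK l N)) :=
    MvPolynomial.algHom_ext h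
  ext f
  obtain ⟨a, b, -, rfl⟩ := IsFractionRing.div_surjective (A := MvPolynomial (Fin N) (k0 l)) f
  rw [map_div₀, map_div₀]
  exact congrArg₂ (· / ·) (DFunLike.congr_fun hpoly a) (DFunLike.congr_fun hpoly b)

/-- A `k0 l`-derivation of `KK l N` vanishing on the generators is zero. -/
theorem KK.derivation_eq_zero (D : Derivation (k0 l) (KK l N) (KK l N))
    (h : ∀ m, D (ww l N m) = 0) : D = 0 := by
  have hpoly : ∀ p : MvPolynomial (Fin N) (k0 l), D (algebraMap _ (KK l N) p) = 0 := by
    intro p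
    induction p using MvPolynomial.induction_on with
    | C a =>
      rw [← MvPolynomial.algebraMap_eq, ← IsScalarTower.algebraMap_apply, D.map_algebraMap]
    | add p q hp hq => rw [map_add, map_add, hp, hq, add_zero]
    | mul_X p m hp =>
      rw [map_mul, D.leibniz, hp, smul_zero, add_zero]
      exact (congrArg _ (h m)).trans (smul_zero _)
  ext f
  obtain ⟨a, b, -, rfl⟩ := IsFractionRing.div_surjective (A := MvPolynomial (Fin N) (k0 l)) f
  rw [D.leibniz_div, hpoly, hpoly]
  simp

/-- An automorphism `s` intertwines two derivations `d` and `d'` as soon as it does so on the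
generators. -/
theorem KK.map_derivation (s : KK l N ≃ₐ[k0 l] KK l N) (d d' : Module.End (k0 l) (KK l N))
    (hd : ∀ a b, d (a * b) = a * d b + d a * b)
    (hd' : ∀ a b, d' (a * b) = a * d' b + d' a * b)
    (h : ∀ m, s (d (ww l N m)) = d' (s (ww l N m))) (f : KK l N) : s (d f) = d' (s f) := by
  let D : Derivation (k0 l) (KK l N) (KK l N) :=
    Derivation.mk' (d - s.symm.toLinearMap ∘ₗ d' ∘ₗ s.toLinearMap) fun a b => by
      simp only [LinearMap.sub_apply, LinearMap.comp_apply, AlgEquiv.toLinearMap_apply, map_mul,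
        map_add, hd, hd', AlgEquiv.symm_apply_apply, smul_eq_mul]
      ring
  have hD : D = 0 := KK.derivation_eq_zero l N D fun m => by
    change d (ww l N m) - s.symm (d' (s (ww l N m))) = 0
    rw [← h, AlgEquiv.symm_apply_apply, sub_self]
  have hf : d f - s.symm (d' (s f)) = 0 := DFunLike.congr_fun hD f
  rw [sub_eq_zero.mp hf, AlgEquiv.apply_symm_apply]

theorem Dop_apply (i : Fin N) (f : KK l N) :
    Dop l N σ pd i f = -(hbar l N * ww l N i * pd i f)
      + ∑ k ∈ ({i}ᶜ : Finset (Fin N)),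
          tt l N * (ww l N i / (ww l N i - ww l N k)) * (f - σ i k f)
      + ∑ k ∈ Finset.Iio i, tt l N * σ i k f := by
  simp [Dop, mulOp, sL, LinearMap.sum_apply, mul_assoc]

theorem statement15 (hN : 1 ≤ N)
    (hσ : ∀ i k, i ≠ k →
      (σ i k) (ww l N i) = ww l N k ∧ (σ i k) (ww l N k) = ww l N i ∧
        ∀ j, j ≠ i → j ≠ k → (σ i k) (ww l N j) = ww l N j)
    (hLeib : ∀ i (a b : KK l N), pd i (a * b) = a * pd i b + pd i a * b)
    (hX : ∀ i j, pd i (ww l N j) = if j = i then 1 else 0)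
    (i j : Fin N) (hij : i < j) :
    sL l N σ i j * Dop l N σ pd i
      = Dop l N σ pd j * sL l N σ i j
        - mulOp l N (tt l N) *
            (1 + ∑ k ∈ Finset.Ioo i j, sL l N σ i k * sL l N σ k j) := by
  have hswap : ∀ a b, a ≠ b → ∀ m, σ a b (ww l N m) = ww l N (Equiv.swap a b m) := by
    intro a b hab m
    obtain ⟨h1, h2, h3⟩ := hσ a b hab
    rcases eq_or_ne m a with rfl | ha
    · rw [h1, Equiv.swap_apply_left]
    rcases eq_or_ne m b with rfl | hb
    · rw [h2, Equiv.swap_apply_right]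
    rw [h3 m ha hb, Equiv.swap_apply_of_ne_of_ne ha hb]
  have hne : i ≠ j := hij.ne
  have hcomp : ∀ a b c d a' b' c' d' : Fin N, a ≠ b → c ≠ d → a' ≠ b' → c' ≠ d' →
      (∀ m, Equiv.swap a b (Equiv.swap c d m) = Equiv.swap a' b' (Equiv.swap c' d' m)) →
      ∀ f, σ a b (σ c d f) = σ a' b' (σ c' d' f) := by
    intro a b c d a' b' c' d' h1 h2 h3 h4 h f
    refine DFunLike.congr_fun (KK.algHom_ext l N
      (φ := (σ a b : KK l N →ₐ[k0 l] KK l N).comp (σ c d))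
      (ψ := (σ a' b' : KK l N →ₐ[k0 l] KK l N).comp (σ c' d')) fun m => ?_) f
    change σ a b (σ c d _) = σ a' b' (σ c' d' _)
    rw [hswap _ _ h2, hswap _ _ h1, hswap _ _ h4, hswap _ _ h3, h]
  have hconj : ∀ k, k ≠ i → ∀ f, σ i j (σ i k f) = σ j (Equiv.swap i j k) (σ i j f) := by
    intro k hk
    have hjk : j ≠ Equiv.swap i j k := fun h => hk <| by
      rw [← Equiv.swap_apply_left i j] at h
      exact ((Equiv.swap i j).injective (by simpa using h)).symm
    refine hcomp _ _ _ _ _ _ _ _ hne hk.symm hjk hne fun m => ?_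
    have := (Equiv.swap i j).swap_apply_apply i k
    rw [Equiv.swap_apply_left] at this
    simp [this]
  have hinv : ∀ f, σ j i (σ i j f) = f := by
    refine DFunLike.congr_fun (KK.algHom_ext l N
      (φ := (σ j i : KK l N →ₐ[k0 l] KK l N).comp (σ i j)) (ψ := AlgHom.id _ _) fun m => ?_)
    change σ j i (σ i j _) = _
    rw [hswap _ _ hne, hswap _ _ hne.symm, Equiv.swap_comm j i, Equiv.swap_apply_self]
    rfl
  have hcycle : ∀ k ∈ Finset.Ioo i j, ∀ f, σ j k (σ i j f) = σ i k (σ k j f) := by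
    intro k hk
    obtain ⟨hik, hkj⟩ := Finset.mem_Ioo.mp hk
    refine hcomp _ _ _ _ _ _ _ _ hkj.ne' hne hik.ne hkj.ne fun m => ?_
    grind
  have hpd : ∀ f, σ i j (pd i f) = pd j (σ i j f) := by
    refine KK.map_derivation l N (σ i j) (pd i) (pd j) (hLeib i) (hLeib j) fun m => ?_
    rw [hswap _ _ hne, hX, hX, apply_ite (σ i j), map_one, map_zero]
    simp only [Equiv.swap_apply_eq_iff, Equiv.swap_apply_right]
  have htt : σ i j (tt l N) = tt l N := (σ i j).commutes _
  have hhb : σ i j (hbar l N) = hbar l N := (σ i j).commutes _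
  ext f
  have hR : (Dop l N σ pd j * sL l N σ i j
      - mulOp l N (tt l N) * (1 + ∑ k ∈ Finset.Ioo i j, sL l N σ i k * sL l N σ k j)) f
      = Dop l N σ pd j (σ i j f)
        - tt l N * (f + ∑ k ∈ Finset.Ioo i j, σ i k (σ k j f)) := by
    simp [mulOp, sL, LinearMap.sum_apply]
  rw [hR]
  change σ i j (Dop l N σ pd i f) = _
  have hsum : ∑ k ∈ ({i}ᶜ : Finset (Fin N)),
        tt l N * (ww l N j / (ww l N j - ww l N (Equiv.swap i j k)))
          * (σ i j f - σ i j (σ i k f))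
      = ∑ k ∈ ({j}ᶜ : Finset (Fin N)),
        tt l N * (ww l N j / (ww l N j - ww l N k)) * (σ i j f - σ j k (σ i j f)) := by
    refine Finset.sum_equiv (Equiv.swap i j) (fun k => ?_) fun k hk => ?_
    · simp [Equiv.swap_apply_eq_iff]
    · rw [hconj k (by simpa using hk)]
  have hlow : ∑ k ∈ Finset.Iio i, tt l N * σ i j (σ i k f)
      = ∑ k ∈ Finset.Iio i, tt l N * σ j k (σ i j f) := by
    refine Finset.sum_congr rfl fun k hk => ?_
    have hki := Finset.mem_Iio.mp hk
    rw [hconj k hki.ne, Equiv.swap_apply_of_ne_of_ne hki.ne (hki.trans hij).ne]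
  have hsplit : ∑ k ∈ Finset.Iio j, tt l N * σ j k (σ i j f)
      = ∑ k ∈ Finset.Iio i, tt l N * σ j k (σ i j f)
        + tt l N * (f + ∑ k ∈ Finset.Ioo i j, σ i k (σ k j f)) := by
    have hIio : Finset.Iio j = Finset.Iio i ∪ insert i (Finset.Ioo i j) := by
      ext k
      simp only [Finset.mem_Iio, Finset.mem_union, Finset.mem_insert, Finset.mem_Ioo]
      grind
    rw [hIio, Finset.sum_union, Finset.sum_insert (by simp), hinv, mul_add, Finset.mul_sum]
    · congr 2
      exact Finset.sum_congr rfl fun k hk => by rw [hcycle k hk]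
    · rw [Finset.disjoint_left]
      intro k
      simp only [Finset.mem_Iio, Finset.mem_insert, Finset.mem_Ioo]
      grind
  rw [Dop_apply, Dop_apply, hsplit, ← hsum, ← hlow]
  simp only [map_add, map_neg, map_mul, map_sum, map_sub, map_div₀, htt, hhb, hpd, hswap i j hne,
    Equiv.swap_apply_left]
  ring
end
end

section
/- Assume l ≥ 1 and fix 1 ≤ i ≤ N. Then the ordered product of operators ∏_{k=1}^{l} (D_i − ħ − z_k + t Σ_{j>i} σ_{ij}) (whose factors pairwise commute, differing only by scalars) equals Σ_{p=0}^{l} t^p Σ_{0 = k_0 < k_1 < ⋯ < k_p ≤ l} Σ_{i = i_0 < i_1 < ⋯ < i_p ≤ N} (∏_{k=k_0+1}^{k_1−1} (D_{i_0} − ħ − z_k)) ∘ (∏_{k=k_1+1}^{k_2−1} (D_{i_1} − ħ − z_k)) ∘ ⋯ ∘ (∏_{k=k_p+1}^{l} (D_{i_p} − ħ − z_k)) ∘ σ_{i_{p−1} i_p} ∘ σ_{i_{p−2} i_{p−1}} ∘ ⋯ ∘ σ_{i_1 i_2} ∘ σ_{i_0 i_1}, as linear endomorphisms of F, where empty products of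 operators are the identity (in particular, the p = 0 summand is ∏_{k=1}^{l} (D_i − ħ − z_k)). -/
/-!
Setup: `k0 l` is the field k₀ = ℂ(ħ, t, z₁, …, z_l) and `KK l N` is the field
K = ℂ(ħ, t, z₁, …, z_l, w₁, …, w_N), realized as the rational function field in
w₁, …, w_N over k₀.  Operators are k₀-linear endomorphisms of K, products of
operators denote composition, and `[A, B] = A * B - B * A`.
-/

open MvPolynomial Finset

set_option synthInstance.maxHeartbeats 1000000
set_option maxHeartbeats 2000000

noncomputable section

variable (l N : ℕ)

/- Here we write X_i for the generator `ww l N i` of F = ℂ(ħ, t, z₁, …, z_l)(X₁, …, X_N),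
`σ i k` (for i ≠ k) is the field automorphism exchanging X_i and X_k and fixing the other
generators, and `pd i` is the partial derivative ∂_i (a k₀-linear derivation with
∂_i X_j = δ_{ij}), both taken as parameters characterized by hypotheses in the theorem. -/

variable (σ : Fin N → Fin N → (KK l N ≃ₐ[k0 l] KK l N))
variable (pd : Fin N → Module.End (k0 l) (KK l N))

/-- z_k for k = 1, …, l with natural-number indexing (junk value 0 otherwise). -/
def zNat (k : ℕ) : KK l N := if h : 1 ≤ k ∧ k ≤ l then zz l N ⟨k - 1, by omega⟩ else 0

/-- The product ∏_{k ∈ s} (D_a − ħ − z_k) over a finite set s of (natural-number)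
indices, composed in increasing order of k (the factors pairwise commute). -/
def segProd (a : Fin N) (s : Finset ℕ) : Op l N :=
  ((s.sort (· ≤ ·)).map
    (fun k => Dop l N σ pd a - mulOp l N (hbar l N + zNat l N k))).prod

/-- The sequence 0 = k_0 < k_1 < ⋯ < k_p given by a p-element set KS ⊆ {1, …, l}:
k_0 = 0 and k_1 < ⋯ < k_p enumerate KS in increasing order. -/
def kseq (p : ℕ) (KS : Finset ℕ) (hK : KS.card = p) (m : ℕ) : ℕ :=
  if m = 0 then 0 else if h : m - 1 < p then (KS.orderIsoOfFin hK ⟨m - 1, h⟩ : ℕ) else 0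

/-- The sequence i = i_0 < i_1 < ⋯ < i_p given by a p-element set S of indices > i:
i_0 = i and i_1 < ⋯ < i_p enumerate S in increasing order. -/
def iseq (p : ℕ) (i : Fin N) (S : Finset (Fin N)) (hS : S.card = p) (m : ℕ) : Fin N :=
  if m = 0 then i else if h : m - 1 < p then ((S.orderIsoOfFin hS ⟨m - 1, h⟩ : S) : Fin N) else i

section Combinatorics

variable {R ι : Type*} [Ring R]

/-- The product `∏_{k ∈ S} Y k`, in increasing order of `k`. -/
def orderedProd (Y : ℕ → R) (S : Finset ℕ) : R := ((S.sort (· ≤ ·)).map Y).prod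

lemma orderedProd_empty (Y : ℕ → R) : orderedProd Y ∅ = 1 := by
  simp [orderedProd]

lemma orderedProd_insert (Y : ℕ → R) {a : ℕ} {S : Finset ℕ} (h : ∀ b ∈ S, a < b) :
    orderedProd Y (insert a S) = Y a * orderedProd Y S := by
  rw [orderedProd, Finset.sort_insert _ (fun b hb => (h b hb).le) (fun ha => lt_irrefl a (h a ha)),
    List.map_cons, List.prod_cons, orderedProd]

lemma orderedProd_Ioc (Y : ℕ → R) {a b : ℕ} (h : a < b) :
    orderedProd Y (Finset.Ioc a b) = Y (a + 1) * orderedProd Y (Finset.Ioc (a + 1) b) := by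
  rw [← orderedProd_insert Y (fun k hk => (Finset.mem_Ioc.1 hk).1)]
  congr 1
  ext k
  simp only [Finset.mem_insert, Finset.mem_Ioc]
  omega

lemma orderedProd_Ioo (Y : ℕ → R) {a b : ℕ} (h : a + 1 < b) :
    orderedProd Y (Finset.Ioo a b) = Y (a + 1) * orderedProd Y (Finset.Ioo (a + 1) b) := by
  rw [← orderedProd_insert Y (fun k hk => (Finset.mem_Ioo.1 hk).1)]
  congr 1
  ext k
  simp only [Finset.mem_insert, Finset.mem_Ioo]
  omega

lemma semiconjBy_orderedProd {x : R} {Y Z : ℕ → R} (h : ∀ k, SemiconjBy x (Y k) (Z k))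
    (S : Finset ℕ) : SemiconjBy x (orderedProd Y S) (orderedProd Z S) := by
  unfold orderedProd
  induction S.sort (· ≤ ·) with
  | nil => simp
  | cons k L ih => simpa using (h k).mul_right ih

/-- The operator attached to chains `a < k₁ < ⋯ < k_p ≤ l` and `i < i₁ < ⋯ < i_p`, given as lists;
it is zero if the lists have different lengths. -/
def chainTerm (Y : ι → ℕ → R) (s : ι → ι → R) (t : R) (l : ℕ) : ℕ → ι → List ℕ → List ι → R
  | a, i, [], [] => orderedProd (Y i) (Finset.Ioc a l)
  | a, i, k :: ks, j :: js =>
      t * (orderedProd (Y i) (Finset.Ioo a k) * chainTerm Y s t l k j ks js * s i j)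
  | _, _, _ :: _, [] => 0
  | _, _, [], _ :: _ => 0

variable {Y : ι → ℕ → R} {s : ι → ι → R} {t : R} {l : ℕ}

lemma chainTerm_eq_zero {ks : List ℕ} {js : List ι} (h : ks.length ≠ js.length) (a : ℕ) (i : ι) :
    chainTerm Y s t l a i ks js = 0 := by
  induction ks generalizing a i js with
  | nil =>
    cases js with
    | nil => simp at h
    | cons j js => rw [chainTerm]
  | cons k ks ih =>
    cases js with
    | nil => rw [chainTerm]
    | cons j js =>
      rw [chainTerm, ih (by simpa using h)]
      simp

lemma chainTerm_of_forall_lt (ht : ∀ x, Commute t x) {a : ℕ} (ha : a < l) (i : ι) {ks : List ℕ}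
    (hk : ∀ k ∈ ks, a + 1 < k) (js : List ι) :
    chainTerm Y s t l a i ks js = Y i (a + 1) * chainTerm Y s t l (a + 1) i ks js := by
  cases ks with
  | nil =>
    cases js with
    | nil => simp only [chainTerm, orderedProd_Ioc _ ha]
    | cons j js => simp [chainTerm]
  | cons k ks =>
    cases js with
    | nil => simp [chainTerm]
    | cons j js =>
      simp only [chainTerm, orderedProd_Ioo (Y i) (hk k (by simp))]
      rw [← mul_assoc (Y i (a + 1)) t, ← (ht (Y i (a + 1))).eq]
      simp only [mul_assoc]

lemma chainTerm_cons_succ (a : ℕ) (i j : ι) (ks : List ℕ) (js : List ι) :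
    chainTerm Y s t l a i ((a + 1) :: ks) (j :: js) =
      t * (chainTerm Y s t l (a + 1) j ks js * s i j) := by
  have h : Finset.Ioo a (a + 1) = ∅ :=
    Finset.eq_empty_of_forall_notMem fun k hk => by
      have hk := Finset.mem_Ioo.1 hk
      omega
  rw [chainTerm, h, orderedProd_empty, one_mul]

lemma chainTerm_ofFn (ht : ∀ x, Commute t x) (p : ℕ) (K : ℕ → ℕ) (I : ℕ → ι) :
    chainTerm Y s t l (K 0) (I 0) (List.ofFn fun m : Fin p => K (m + 1))
        (List.ofFn fun m : Fin p => I (m + 1)) =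
      t ^ p *
        (List.ofFn fun m : Fin p => orderedProd (Y (I m)) (Finset.Ioo (K m) (K (m + 1)))).prod *
        orderedProd (Y (I p)) (Finset.Ioc (K p) l) *
        (List.ofFn fun m : Fin p => s (I (p - 1 - m)) (I (p - m))).prod := by
  induction p generalizing K I with
  | zero => simp [chainTerm]
  | succ p ih =>
    have h := ih (fun m => K (m + 1)) (fun m => I (m + 1))
    simp only [Nat.zero_add] at h
    rw [List.ofFn_succ, List.ofFn_succ, chainTerm]
    simp only [Fin.val_succ, Fin.val_zero, Nat.zero_add]
    rw [h, List.ofFn_succ, List.ofFn_succ_last (f := fun m : Fin (p + 1) => s _ _)]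
    have e : ∀ m : Fin p, p - 1 - (m : ℕ) + 1 = p + 1 - 1 - m ∧ p - (m : ℕ) + 1 = p + 1 - m :=
      fun m => by omega
    simp only [e, Fin.val_castSucc, Fin.val_last, Fin.val_succ, Fin.val_zero, Nat.zero_add,
      List.prod_cons, List.prod_append, List.prod_nil, mul_one, Nat.add_sub_cancel, Nat.sub_self,
      Nat.add_sub_cancel_left, pow_succ']
    set A := orderedProd (Y (I 0)) (Finset.Ioo (K 0) (K 1))
    have hc : A * t ^ p = t ^ p * A := ((ht A).pow_left p).eq.symm
    simp only [← mul_assoc]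
    rw [mul_assoc t A, hc]
    simp only [mul_assoc]

lemma sum_powerset_eq_sum_min [LinearOrder ι] {M : Type*} [AddCommMonoid M] (f : Finset ι → M)
    (T : Finset ι) :
    ∑ S ∈ T.powerset, f S = f ∅ + ∑ j ∈ T, ∑ S ∈ (T.filter (j < ·)).powerset, f (insert j S) := by
  induction T using Finset.induction_on_min with
  | empty => simp
  | insert a T ha ih =>
    have hna : a ∉ T := fun h => lt_irrefl a (ha a h)
    have h1 : (insert a T).filter (a < ·) = T := by
      rw [Finset.filter_insert, if_neg (lt_irrefl a), Finset.filter_true_of_mem ha]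
    have h2 : ∀ j ∈ T, (insert a T).filter (j < ·) = T.filter (j < ·) := fun j hj => by
      rw [Finset.filter_insert, if_neg (ha j hj).not_gt]
    rw [Finset.sum_powerset_insert hna, Finset.sum_insert hna, h1, ih,
      Finset.sum_congr rfl fun j hj => by rw [← h2 j hj], add_assoc, add_comm (∑ j ∈ T, _)]

variable [LinearOrder ι] [LocallyFiniteOrderTop ι]

lemma sum_powerset_Ioi {M : Type*} [AddCommMonoid M] (f : Finset ι → M) (i : ι) :
    ∑ S ∈ (Finset.Ioi i).powerset, f S =
      f ∅ + ∑ j ∈ Finset.Ioi i, ∑ S ∈ (Finset.Ioi j).powerset, f (insert j S) := by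
  rw [sum_powerset_eq_sum_min]
  congr 1
  refine Finset.sum_congr rfl fun j hj => ?_
  congr 2
  ext m
  simp only [Finset.mem_filter, Finset.mem_Ioi, and_iff_right_iff_imp]
  exact (Finset.mem_Ioi.1 hj).trans

/-- The sum of `chainTerm` over all chains in `(a, l]` and above `i`. -/
def chainSum (Y : ι → ℕ → R) (s : ι → ι → R) (t : R) (l a : ℕ) (i : ι) : R :=
  ∑ KS ∈ (Finset.Ioc a l).powerset, ∑ S ∈ (Finset.Ioi i).powerset,
    chainTerm Y s t l a i (KS.sort (· ≤ ·)) (S.sort (· ≤ ·))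

lemma chainSum_self (i : ι) : chainSum Y s t l l i = 1 := by
  simp only [chainSum, Finset.Ioc_self, Finset.powerset_empty, Finset.sum_singleton,
    Finset.sort_empty]
  rw [Finset.sum_eq_single ∅]
  · simp [chainTerm, orderedProd_empty]
  · intro S _ hS
    refine chainTerm_eq_zero ?_ _ _
    simpa [eq_comm] using hS
  · simp

lemma chainSum_of_lt (ht : ∀ x, Commute t x) {a : ℕ} (ha : a < l) (i : ι) :
    chainSum Y s t l a i = Y i (a + 1) * chainSum Y s t l (a + 1) i +
      t * ∑ j ∈ Finset.Ioi i, chainSum Y s t l (a + 1) j * s i j := by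
  have hmem : ∀ KS ∈ (Finset.Ioc (a + 1) l).powerset, ∀ k ∈ KS, a + 1 < k := fun KS hKS k hk =>
    (Finset.mem_Ioc.1 (Finset.mem_powerset.1 hKS hk)).1
  have hIoc : Finset.Ioc a l = insert (a + 1) (Finset.Ioc (a + 1) l) := by
    ext k
    simp only [Finset.mem_insert, Finset.mem_Ioc]
    omega
  rw [chainSum, hIoc, Finset.sum_powerset_insert (by simp)]
  congr 1
  · rw [chainSum, Finset.mul_sum]
    refine Finset.sum_congr rfl fun KS hKS => ?_
    rw [Finset.mul_sum]
    refine Finset.sum_congr rfl fun S _ => ?_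
    exact chainTerm_of_forall_lt ht ha i (fun k hk => hmem KS hKS k ((Finset.mem_sort _).1 hk)) _
  · simp only [chainSum, Finset.sum_mul, Finset.mul_sum]
    conv_rhs => rw [Finset.sum_comm]
    refine Finset.sum_congr rfl fun KS hKS => ?_
    rw [Finset.sort_insert _ (fun b hb => (hmem KS hKS b hb).le)
      (fun h => lt_irrefl _ (hmem KS hKS _ h)), sum_powerset_Ioi, Finset.sort_empty,
      chainTerm_eq_zero (by simp), zero_add]
    refine Finset.sum_congr rfl fun j _ => Finset.sum_congr rfl fun S hS => ?_
    have hlt : ∀ b ∈ S, j < b := fun b hb => Finset.mem_Ioi.1 (Finset.mem_powerset.1 hS hb)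
    rw [Finset.sort_insert _ (fun b hb => (hlt b hb).le) (fun h => lt_irrefl _ (hlt _ h)),
      chainTerm_cons_succ]

lemma chainSum_eq_orderedProd (ht : ∀ x, Commute t x)
    (hs : ∀ i j, i < j → ∀ k, SemiconjBy (s i j) (Y i k + t * ∑ m ∈ Finset.Ioi i, s i m)
      (Y j k + t * ∑ m ∈ Finset.Ioi j, s j m)) {a : ℕ} (ha : a ≤ l) (i : ι) :
    chainSum Y s t l a i =
      orderedProd (fun k => Y i k + t * ∑ m ∈ Finset.Ioi i, s i m) (Finset.Ioc a l) := by
  induction ha using Nat.decreasingInduction generalizing i with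
  | self => rw [chainSum_self, Finset.Ioc_self, orderedProd_empty]
  | of_succ a ha ih =>
    rw [chainSum_of_lt ht ha, orderedProd_Ioc _ ha, add_mul, ← ih, mul_assoc t, Finset.sum_mul]
    congr 2
    refine Finset.sum_congr rfl fun j hj => ?_
    rw [ih, ih]
    exact (semiconjBy_orderedProd (hs i j (Finset.mem_Ioi.1 hj)) _).eq.symm

end Combinatorics

section Dunkl

variable {l N : ℕ} {σ : Fin N → Fin N → (KK l N ≃ₐ[k0 l] KK l N)}
  {pd : Fin N → Module.End (k0 l) (KK l N)}

lemma KK_algHom_ext {f g : KK l N →ₐ[k0 l] KK l N} (h : ∀ m, f (ww l N m) = g (ww l N m)) :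
    f = g :=
  IsLocalization.algHom_ext (nonZeroDivisors (MvPolynomial (Fin N) (k0 l)))
    (MvPolynomial.algHom_ext h)

lemma KK_leibniz_ext {D E : Op l N} (hD : ∀ a b, D (a * b) = a * D b + D a * b)
    (hE : ∀ a b, E (a * b) = a * E b + E a * b) (h : ∀ m, D (ww l N m) = E (ww l N m)) :
    D = E := by
  have one_eq_zero : ∀ {G : Op l N}, (∀ a b, G (a * b) = a * G b + G a * b) → G 1 = 0 :=
    fun {G} hG => by simpa using hG 1 1
  have hpoly : ∀ P : MvPolynomial (Fin N) (k0 l),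
      D (algebraMap _ (KK l N) P) = E (algebraMap _ (KK l N) P) := by
    intro P
    induction P using MvPolynomial.induction_on with
    | C a =>
      have hC : algebraMap (MvPolynomial (Fin N) (k0 l)) (KK l N) (C a) = a • (1 : KK l N) := by
        rw [← MvPolynomial.algebraMap_eq, ← IsScalarTower.algebraMap_apply,
          Algebra.algebraMap_eq_smul_one]
      rw [hC, map_smul, map_smul, one_eq_zero hD, one_eq_zero hE]
    | add P Q hP hQ => rw [map_add, map_add, map_add, hP, hQ]
    | mul_X P m hP =>
      have hm := h m
      rw [ww] at hm
      rw [map_mul, hD, hE, hP, hm]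
  refine LinearMap.ext fun x => ?_
  obtain ⟨P, Q, hQ, rfl⟩ := IsFractionRing.div_surjective (A := MvPolynomial (Fin N) (k0 l)) x
  have hQ0 : algebraMap _ (KK l N) Q ≠ 0 := IsFractionRing.to_map_ne_zero_of_mem_nonZeroDivisors hQ
  have hDx := hD (algebraMap _ (KK l N) P / algebraMap _ (KK l N) Q) (algebraMap _ (KK l N) Q)
  have hEx := hE (algebraMap _ (KK l N) P / algebraMap _ (KK l N) Q) (algebraMap _ (KK l N) Q)
  rw [div_mul_cancel₀ _ hQ0, hpoly, hpoly Q] at hDx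
  rw [div_mul_cancel₀ _ hQ0] at hEx
  rw [hDx, add_right_inj] at hEx
  exact mul_right_cancel₀ hQ0 hEx

lemma mulOp_apply (a x : KK l N) : mulOp l N a x = a * x := rfl

lemma sL_apply (i k : Fin N) (x : KK l N) : sL l N σ i k x = σ i k x := rfl

lemma mulOp_mul (a b : KK l N) : mulOp l N (a * b) = mulOp l N a * mulOp l N b :=
  LinearMap.ext fun x => mul_assoc a b x

lemma mulOp_pow (a : KK l N) (p : ℕ) : mulOp l N (a ^ p) = mulOp l N a ^ p := by
  induction p with
  | zero => exact LinearMap.ext fun x => by simp [mulOp_apply]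
  | succ p ih => rw [pow_succ, mulOp_mul, ih, pow_succ]

lemma mulOp_algebraMap_commute (c : k0 l) (A : Op l N) :
    Commute (mulOp l N (algebraMap (k0 l) (KK l N) c)) A :=
  LinearMap.ext fun x => by
    simp [Module.End.mul_apply, mulOp_apply, ← Algebra.smul_def]

lemma semiconjBy_sL_mulOp (i j : Fin N) (a : KK l N) :
    SemiconjBy (sL l N σ i j) (mulOp l N a) (mulOp l N (σ i j a)) :=
  LinearMap.ext fun x => by simp [Module.End.mul_apply, mulOp_apply, sL_apply]

lemma exists_algebraMap_eq_hbar_add_zNat (k : ℕ) :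
    ∃ c : k0 l, hbar l N + zNat l N k = algebraMap (k0 l) (KK l N) c := by
  unfold zNat
  split_ifs with h
  · exact ⟨hb0 l + zz0 l ⟨k - 1, by omega⟩, by rw [map_add]; rfl⟩
  · exact ⟨hb0 l, by rw [add_zero]; rfl⟩

/-- `σ i k` permutes the generators by the transposition of `i` and `k`. -/
lemma sigma_ww
    (hσ : ∀ i k, i ≠ k →
      (σ i k) (ww l N i) = ww l N k ∧ (σ i k) (ww l N k) = ww l N i ∧
        ∀ j, j ≠ i → j ≠ k → (σ i k) (ww l N j) = ww l N j)
    {i k : Fin N} (hik : i ≠ k) (m : Fin N) :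
    σ i k (ww l N m) = ww l N (Equiv.swap i k m) := by
  obtain ⟨h1, h2, h3⟩ := hσ i k hik
  rcases eq_or_ne m i with rfl | hmi
  · rw [h1, Equiv.swap_apply_left]
  rcases eq_or_ne m k with rfl | hmk
  · rw [h2, Equiv.swap_apply_right]
  rw [h3 m hmi hmk, Equiv.swap_apply_of_ne_of_ne hmi hmk]

lemma semiconjBy_sL_sL
    (hw : ∀ i k, i ≠ k → ∀ m, σ i k (ww l N m) = ww l N (Equiv.swap i k m))
    {i j k : Fin N} (hij : i ≠ j) (hik : i ≠ k) :
    SemiconjBy (sL l N σ i j) (sL l N σ i k) (sL l N σ j (Equiv.swap i j k)) := by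
  have hjk : j ≠ Equiv.swap i j k := fun h => hik <| by
    simpa using congrArg (Equiv.swap i j) h
  have h : ((σ i j : KK l N →ₐ[k0 l] KK l N)).comp (σ i k : KK l N →ₐ[k0 l] KK l N) =
      (σ j (Equiv.swap i j k) : KK l N →ₐ[k0 l] KK l N).comp
        (σ i j : KK l N →ₐ[k0 l] KK l N) := by
    refine KK_algHom_ext fun m => ?_
    change σ i j (σ i k (ww l N m)) = σ j (Equiv.swap i j k) (σ i j (ww l N m))
    rw [hw _ _ hik, hw _ _ hij, hw _ _ hij, hw _ _ hjk]
    have := congrArg (fun e : Equiv.Perm (Fin N) => e m)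
      (Equiv.mul_swap_eq_swap_mul (Equiv.swap i j) i k)
    simp only [Equiv.Perm.mul_apply, Equiv.swap_apply_left] at this
    rw [this]
  exact LinearMap.ext fun x => DFunLike.congr_fun h x

lemma semiconjBy_sL_pd
    (hw : ∀ i k, i ≠ k → ∀ m, σ i k (ww l N m) = ww l N (Equiv.swap i k m))
    (hLeib : ∀ i (a b : KK l N), pd i (a * b) = a * pd i b + pd i a * b)
    (hX : ∀ i j, pd i (ww l N j) = if j = i then 1 else 0)
    {i j : Fin N} (hij : i ≠ j) : SemiconjBy (sL l N σ i j) (pd i) (pd j) := by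
  have h : pd i = (σ i j).symm.toLinearMap * pd j * (σ i j).toLinearMap := by
    refine KK_leibniz_ext (hLeib i) (fun a b => ?_) (fun m => ?_)
    · simp [Module.End.mul_apply, hLeib]
    · have hm : Equiv.swap i j m = j ↔ m = i := by
        rw [Equiv.swap_apply_eq_iff, Equiv.swap_apply_right]
      simp only [Module.End.mul_apply, AlgEquiv.toLinearMap_apply, hw _ _ hij, hX, hm]
      split_ifs <;> simp
  refine LinearMap.ext fun x => ?_
  rw [h]
  simp [Module.End.mul_apply, sL_apply]

/-- The symmetrized Dunkl operator `D_i + t Σ_{j > i} σ_{ij}` involves all indices `k ≠ i`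
alike. -/
lemma Dop_add_sum_Ioi (i : Fin N) :
    Dop l N σ pd i + mulOp l N (tt l N) * ∑ j ∈ Finset.Ioi i, sL l N σ i j =
      -(mulOp l N (hbar l N * ww l N i) * pd i) +
      ∑ k ∈ ({i}ᶜ : Finset (Fin N)),
        (mulOp l N (tt l N * (ww l N i / (ww l N i - ww l N k))) * (1 - sL l N σ i k) +
          mulOp l N (tt l N) * sL l N σ i k) := by
  have h : ({i}ᶜ : Finset (Fin N)) = Finset.Iio i ∪ Finset.Ioi i := by
    ext k
    simp
  have hd : Disjoint (Finset.Iio i) (Finset.Ioi i) :=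
    Finset.disjoint_left.2 fun k h1 h2 =>
      lt_asymm (Finset.mem_Iio.1 h1) (Finset.mem_Ioi.1 h2)
  rw [Finset.sum_add_distrib, Dop, Finset.mul_sum, add_assoc, add_assoc]
  rw [← Finset.sum_union hd, ← h]

lemma semiconjBy_sL_Dop
    (hw : ∀ i k, i ≠ k → ∀ m, σ i k (ww l N m) = ww l N (Equiv.swap i k m))
    (hLeib : ∀ i (a b : KK l N), pd i (a * b) = a * pd i b + pd i a * b)
    (hX : ∀ i j, pd i (ww l N j) = if j = i then 1 else 0)
    {i j : Fin N} (hij : i ≠ j) :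
    SemiconjBy (sL l N σ i j)
      (Dop l N σ pd i + mulOp l N (tt l N) * ∑ m ∈ Finset.Ioi i, sL l N σ i m)
      (Dop l N σ pd j + mulOp l N (tt l N) * ∑ m ∈ Finset.Ioi j, sL l N σ j m) := by
  have htt : σ i j (tt l N) = tt l N := (σ i j).commutes _
  have hhb : σ i j (hbar l N) = hbar l N := (σ i j).commutes _
  have hmul : ∀ a b, σ i j a = b →
      SemiconjBy (sL l N σ i j) (mulOp l N a) (mulOp l N b) := by
    rintro a _ rfl
    exact semiconjBy_sL_mulOp i j a
  rw [Dop_add_sum_Ioi, Dop_add_sum_Ioi]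
  refine SemiconjBy.add_right (SemiconjBy.neg_right (SemiconjBy.mul_right (hmul _ _ ?_)
    (semiconjBy_sL_pd hw hLeib hX hij))) ?_
  · rw [map_mul, hhb, hw _ _ hij, Equiv.swap_apply_left]
  · rw [SemiconjBy, Finset.mul_sum, Finset.sum_mul]
    refine Finset.sum_equiv (Equiv.swap i j) (fun k => ?_) (fun k hk => ?_)
    · simp only [Finset.mem_compl, Finset.mem_singleton, not_iff_not]
      rw [Equiv.swap_apply_eq_iff, Equiv.swap_apply_right]
    · have hik : i ≠ k := fun h => by simp [h] at hk
      have hs := semiconjBy_sL_sL hw hij hik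
      refine SemiconjBy.add_right (SemiconjBy.mul_right (hmul _ _ ?_)
        ((SemiconjBy.one_right _).sub_right hs)) (SemiconjBy.mul_right (hmul _ _ htt) hs)
      rw [map_mul, map_div₀, map_sub, htt, hw _ _ hij, hw _ _ hij, Equiv.swap_apply_left]

lemma ofFn_kseq {p : ℕ} {KS : Finset ℕ} (hK : KS.card = p) :
    (List.ofFn fun m : Fin p => kseq p KS hK (m + 1)) = KS.sort (· ≤ ·) := by
  rw [← Finset.listMap_orderEmbOfFin_finRange KS hK, List.ofFn_eq_map]
  refine List.map_congr_left fun m _ => ?_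
  simp [kseq]

lemma ofFn_iseq {p : ℕ} (i : Fin N) {S : Finset (Fin N)} (hS : S.card = p) :
    (List.ofFn fun m : Fin p => iseq N p i S hS (m + 1)) = S.sort (· ≤ ·) := by
  rw [← Finset.listMap_orderEmbOfFin_finRange S hS, List.ofFn_eq_map]
  refine List.map_congr_left fun m _ => ?_
  simp [iseq]

end Dunkl

theorem statement18 (hN : 1 ≤ N) (hl : 1 ≤ l)
    (hσ : ∀ i k, i ≠ k →
      (σ i k) (ww l N i) = ww l N k ∧ (σ i k) (ww l N k) = ww l N i ∧
        ∀ j, j ≠ i → j ≠ k → (σ i k) (ww l N j) = ww l N j)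
    (hLeib : ∀ i (a b : KK l N), pd i (a * b) = a * pd i b + pd i a * b)
    (hX : ∀ i j, pd i (ww l N j) = if j = i then 1 else 0)
    (i : Fin N) :
    (((Finset.Icc 1 l).sort (· ≤ ·)).map
      (fun k => Dop l N σ pd i - mulOp l N (hbar l N + zNat l N k)
        + mulOp l N (tt l N) * ∑ j ∈ Finset.Ioi i, sL l N σ i j)).prod
    = ∑ p ∈ Finset.range (l + 1),
        ∑ KS ∈ (Finset.Icc 1 l).powersetCard p,
          ∑ S ∈ (Finset.Ioi i).powersetCard p,
            if hK : KS.card = p then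
              if hS : S.card = p then
                mulOp l N (tt l N ^ p) *
                ((List.ofFn (fun m : Fin p =>
                    segProd l N σ pd (iseq N p i S hS (m : ℕ))
                      (Finset.Ioo (kseq p KS hK (m : ℕ)) (kseq p KS hK ((m : ℕ) + 1))))).prod) *
                segProd l N σ pd (iseq N p i S hS p) (Finset.Ioc (kseq p KS hK p) l) *
                ((List.ofFn (fun m : Fin p =>
                    sL l N σ (iseq N p i S hS (p - 1 - (m : ℕ)))
                      (iseq N p i S hS (p - (m : ℕ))))).prod)
              else 0
            else 0 := by
  set Y : Fin N → ℕ → Op l N := fun a k => Dop l N σ pd a - mulOp l N (hbar l N + zNat l N k)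
    with hY
  have ht : ∀ A : Op l N, Commute (mulOp l N (tt l N)) A := mulOp_algebraMap_commute (tt0 l)
  have hs : ∀ a b : Fin N, a < b → ∀ k, SemiconjBy (sL l N σ a b)
      (Y a k + mulOp l N (tt l N) * ∑ m ∈ Finset.Ioi a, sL l N σ a m)
      (Y b k + mulOp l N (tt l N) * ∑ m ∈ Finset.Ioi b, sL l N σ b m) := by
    intro a b hab k
    obtain ⟨c, hc⟩ := exists_algebraMap_eq_hbar_add_zNat (l := l) (N := N) k
    simp only [hY, hc, sub_add_eq_add_sub]
    exact (semiconjBy_sL_Dop (fun _ _ h => sigma_ww hσ h) hLeib hX hab.ne).sub_right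
      (mulOp_algebraMap_commute c _).symm
  refine (chainSum_eq_orderedProd ht hs (Nat.zero_le l) i).symm.trans ?_
  have hcard : ∀ KS ∈ (Finset.Icc 1 l).powerset, KS.card ∈ Finset.range (l + 1) := fun KS hKS => by
    have := Finset.card_le_card (Finset.mem_powerset.1 hKS)
    rw [Nat.card_Icc] at this
    exact Finset.mem_range.2 (by omega)
  rw [chainSum, show Finset.Ioc 0 l = Finset.Icc 1 l from rfl,
    ← Finset.sum_fiberwise_of_maps_to hcard]
  refine Finset.sum_congr rfl fun p _ => ?_
  rw [← Finset.powersetCard_eq_filter]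
  refine Finset.sum_congr rfl fun KS hKS => ?_
  have hK : KS.card = p := (Finset.mem_powersetCard.1 hKS).2
  rw [Finset.powersetCard_eq_filter, Finset.sum_filter]
  refine Finset.sum_congr rfl fun S _ => ?_
  rw [dif_pos hK]
  split_ifs with hS
  · rw [← ofFn_kseq hK, ← ofFn_iseq i hS, mulOp_pow]
    exact chainTerm_ofFn ht p (kseq p KS hK) (iseq N p i S hS)
  · exact chainTerm_eq_zero (by simpa [hK, eq_comm] using hS) _ _
end
end
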